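/- Let n ≥ 1, let S be an S-path of n+1 coordinates with increments m_j = S_j − S_{j−1}, and let ψ : ℕ × ℕ → ℝ satisfy ψ(m_j, j) > 0 for every j with m_j > 0. For a partition p of {1, …, n} define the weight w(p) = ∏_{C ∈ p} ψ(|C|, max C). Then w(p) takes the same positive value for every partition p corresponding to S, and consequently for each such p, w(p) divided by the sum of w(p') over all partitions p' corresponding to S equals 1 / ∏_{j : m_j > 0} binom(j − 1 − S_{j−1}, j − S_j); that is, the conditional distribution over partitions corresponding to S induced by the weights w is the uniform distribution on C_S. -/

import Mathlib

/-- An S-path of `n+1` coordinates. -/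
def IsSPath (n : ℕ) (S : ℕ → ℕ) : Prop :=
  S 0 = 0 ∧ S n = n ∧ (∀ j < n, S j ≤ j) ∧ ∀ j < n, S j ≤ S (j + 1)

/-- A partition `p` of `{1,…,n}` corresponds to the S-path `S`. -/
def Corresponds (n : ℕ) (p : Finpartition (Finset.Icc 1 n)) (S : ℕ → ℕ) : Prop :=
  ∀ j ∈ Finset.Icc 1 n,
    ((∃ C ∈ p.parts, C.sup id = j) ↔ S (j - 1) < S j) ∧
    ∀ C ∈ p.parts, C.sup id = j → C.card = S j - S (j - 1)

/-- `Q` is a family of disjoint nonempty cells in `{1,…,k}` whose maxima and sizes are those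
prescribed by the first `k` increments of `S`. -/
structure IsPartialFamily (S : ℕ → ℕ) (k : ℕ) (Q : Finset (Finset ℕ)) : Prop where
  nonempty : ∀ C ∈ Q, C.Nonempty
  subset : ∀ C ∈ Q, C ⊆ Finset.Icc 1 k
  card_eq : ∀ C ∈ Q, C.card = S (C.sup id) - S (C.sup id - 1)
  disj : ∀ C ∈ Q, ∀ D ∈ Q, C ≠ D → Disjoint C D
  sup_iff : ∀ j ∈ Finset.Icc 1 k, (∃ C ∈ Q, C.sup id = j) ↔ S (j - 1) < S j

theorem sup_id_mem {C : Finset ℕ} (h : C.Nonempty) : C.sup id ∈ C := by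
  obtain ⟨x, hx, hxe⟩ := Finset.exists_mem_eq_sup C h id
  rw [hxe]
  exact hx

theorem le_sup_id {C : Finset ℕ} {x : ℕ} (h : x ∈ C) : x ≤ C.sup id :=
  Finset.le_sup (f := id) h

namespace IsPartialFamily

variable {S : ℕ → ℕ} {k : ℕ} {Q : Finset (Finset ℕ)}

theorem sup_mem_Icc (h : IsPartialFamily S k Q) {C : Finset ℕ} (hC : C ∈ Q) :
    C.sup id ∈ Finset.Icc 1 k :=
  h.subset C hC (sup_id_mem (h.nonempty C hC))

theorem sup_injOn (h : IsPartialFamily S k Q) :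
    Set.InjOn (fun C : Finset ℕ => C.sup id) (Q : Set (Finset ℕ)) := by
  intro C hC D hD hCD
  by_contra hne
  have h1 := sup_id_mem (h.nonempty C hC)
  have h2 := sup_id_mem (h.nonempty D hD)
  have h3 : C.sup id = D.sup id := hCD
  rw [← h3] at h2
  exact Finset.disjoint_left.1 (h.disj C hC D hD hne) h1 h2

theorem image_sup (h : IsPartialFamily S k Q) :
    Q.image (fun C => C.sup id) = (Finset.Icc 1 k).filter (fun j => S (j - 1) < S j) := by
  ext j
  simp only [Finset.mem_image, Finset.mem_filter]
  constructor
  · rintro ⟨C, hC, rfl⟩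
    exact ⟨h.sup_mem_Icc hC, (h.sup_iff _ (h.sup_mem_Icc hC)).1 ⟨C, hC, rfl⟩⟩
  · rintro ⟨hj, hlt⟩
    exact (h.sup_iff j hj).2 hlt

@[to_additive]
theorem prod_eq {M : Type*} [CommMonoid M] (h : IsPartialFamily S k Q) (F : ℕ × ℕ → M) :
    ∏ C ∈ Q, F (C.card, C.sup id) =
      ∏ j ∈ (Finset.Icc 1 k).filter (fun j => S (j - 1) < S j), F (S j - S (j - 1), j) := by
  rw [← h.image_sup, Finset.prod_image h.sup_injOn]
  exact Finset.prod_congr rfl fun C hC => by rw [h.card_eq C hC]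

end IsPartialFamily

theorem sum_increments {S : ℕ → ℕ} (h0 : S 0 = 0) :
    ∀ k, (∀ j < k, S j ≤ S (j + 1)) →
      ∑ j ∈ (Finset.Icc 1 k).filter (fun j => S (j - 1) < S j), (S j - S (j - 1)) = S k := by
  intro k hmono
  rw [Finset.sum_filter_of_ne (fun j _ hne => by omega)]
  induction k with
  | zero => simp [h0]
  | succ k ih =>
    rw [Finset.sum_Icc_succ_top (by omega), ih fun j hj => hmono j (by omega)]
    have := hmono k (by omega)
    simp only [Nat.add_sub_cancel]
    omega

theorem IsPartialFamily.card_sup {S : ℕ → ℕ} {k : ℕ} {Q : Finset (Finset ℕ)}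
    (h : IsPartialFamily S k Q) (h0 : S 0 = 0) (hmono : ∀ j < k, S j ≤ S (j + 1)) :
    (Q.sup id).card = S k := by
  rw [Finset.sup_eq_biUnion, Finset.card_biUnion (t := id) h.disj, ← sum_increments h0 k hmono]
  exact h.sum_eq Prod.fst

theorem IsPartialFamily.sup_subset {S : ℕ → ℕ} {k : ℕ} {Q : Finset (Finset ℕ)}
    (h : IsPartialFamily S k Q) : Q.sup id ⊆ Finset.Icc 1 k :=
  Finset.sup_le h.subset

theorem IsPartialFamily.succ_notMem {S : ℕ → ℕ} {k : ℕ} {Q : Finset (Finset ℕ)}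
    (h : IsPartialFamily S k Q) {C : Finset ℕ} (hC : C ∈ Q) : k + 1 ∉ C := fun hk => by
  have := Finset.mem_Icc.1 (h.subset C hC hk)
  omega

theorem sup_insert_succ {k : ℕ} {A : Finset ℕ} (hA : A ⊆ Finset.Icc 1 k) :
    (insert (k + 1) A).sup id = k + 1 := by
  rw [Finset.sup_insert]
  refine sup_eq_left.2 (Finset.sup_le fun x hx => ?_)
  have := Finset.mem_Icc.1 (hA hx)
  simp only [id]
  omega

theorem sup_id_eq_succ_of_mem {k : ℕ} {C : Finset ℕ} (hC : C ⊆ Finset.Icc 1 (k + 1))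
    (hk : k + 1 ∈ C) : C.sup id = k + 1 :=
  le_antisymm (Finset.sup_le fun _ hx => (Finset.mem_Icc.1 (hC hx)).2) (le_sup_id hk)

theorem isPartialFamily_succ_of_eq {S : ℕ → ℕ} {k : ℕ} (hk : ¬ S k < S (k + 1))
    (Q : Finset (Finset ℕ)) : IsPartialFamily S (k + 1) Q ↔ IsPartialFamily S k Q := by
  constructor
  · intro h
    refine ⟨h.nonempty, fun C hC x hx => ?_, h.card_eq, h.disj, fun j hj => h.sup_iff j ?_⟩
    · have h1 := Finset.mem_Icc.1 (h.subset C hC hx)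
      have h2 : x ≠ k + 1 := by
        rintro rfl
        exact hk ((h.sup_iff (k + 1) (by simp)).1
          ⟨C, hC, sup_id_eq_succ_of_mem (h.subset C hC) hx⟩)
      exact Finset.mem_Icc.2 (by omega)
    · rw [Finset.mem_Icc] at *
      omega
  · intro h
    refine ⟨h.nonempty, fun C hC => (h.subset C hC).trans
      (Finset.Icc_subset_Icc_right (by omega)), h.card_eq, h.disj, fun j hj => ?_⟩
    rcases eq_or_ne j (k + 1) with rfl | hne
    · refine iff_of_false ?_ hk
      rintro ⟨C, hC, hs⟩
      have := Finset.mem_Icc.1 (h.sup_mem_Icc hC)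
      omega
    · refine h.sup_iff j ?_
      rw [Finset.mem_Icc] at *
      omega

theorem IsPartialFamily.insert_succ {S : ℕ → ℕ} {k : ℕ} (hk : S k < S (k + 1))
    {Q : Finset (Finset ℕ)} (h : IsPartialFamily S k Q) {A : Finset ℕ}
    (hA : A ⊆ Finset.Icc 1 k \ Q.sup id) (hcard : A.card = S (k + 1) - S k - 1) :
    IsPartialFamily S (k + 1) (insert (insert (k + 1) A) Q) := by
  have hA' : A ⊆ Finset.Icc 1 k := hA.trans Finset.sdiff_subset
  have hsup := sup_insert_succ hA'
  have hdisj : ∀ D ∈ Q, Disjoint (insert (k + 1) A) D := fun D hD => by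
    rw [Finset.disjoint_insert_left]
    refine ⟨h.succ_notMem hD, ?_⟩
    have h1 : D ⊆ Q.sup id := Finset.le_sup (f := id) hD
    exact Finset.disjoint_of_subset_left hA
      (Finset.disjoint_of_subset_right h1 Finset.sdiff_disjoint)
  constructor
  · simp only [Finset.forall_mem_insert]
    exact ⟨Finset.insert_nonempty _ _, h.nonempty⟩
  · simp only [Finset.forall_mem_insert]
    refine ⟨Finset.insert_subset (by simp)
      (hA'.trans (Finset.Icc_subset_Icc_right (by omega))), fun C hC => (h.subset C hC).trans
      (Finset.Icc_subset_Icc_right (by omega))⟩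
  · simp only [Finset.forall_mem_insert]
    refine ⟨?_, h.card_eq⟩
    have hnot : k + 1 ∉ A := fun hm => by
      have := Finset.mem_Icc.1 (hA' hm)
      omega
    rw [hsup, Finset.card_insert_of_notMem hnot, hcard, Nat.add_sub_cancel]
    omega
  · intro C hC D hD hne
    rw [Finset.mem_insert] at hC hD
    rcases hC with rfl | hC <;> rcases hD with rfl | hD
    · exact absurd rfl hne
    · exact hdisj D hD
    · exact (hdisj C hC).symm
    · exact h.disj C hC D hD hne
  · intro j hj
    rw [Finset.exists_mem_insert, hsup]
    rcases eq_or_ne j (k + 1) with rfl | hne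
    · exact iff_of_true (Or.inl rfl) hk
    · rw [or_iff_right hne.symm]
      refine h.sup_iff j ?_
      rw [Finset.mem_Icc] at *
      omega

theorem IsPartialFamily.erase_succ {S : ℕ → ℕ} {k : ℕ} {R : Finset (Finset ℕ)}
    (h : IsPartialFamily S (k + 1) R) {C : Finset ℕ} (hC : C ∈ R) (hkC : k + 1 ∈ C) :
    IsPartialFamily S k (R.erase C) := by
  have hmem : ∀ D ∈ R.erase C, D ∈ R := fun D => Finset.mem_of_mem_erase
  refine ⟨fun D hD => h.nonempty D (hmem D hD), fun D hD x hx => ?_,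
    fun D hD => h.card_eq D (hmem D hD), fun D hD E hE => h.disj D (hmem D hD) E (hmem E hE),
    fun j hj => ?_⟩
  · have h1 := Finset.mem_Icc.1 (h.subset D (hmem D hD) hx)
    have h2 : x ≠ k + 1 := by
      rintro rfl
      exact Finset.disjoint_left.1
        (h.disj D (hmem D hD) C hC (Finset.ne_of_mem_erase hD)) hx hkC
    exact Finset.mem_Icc.2 (by omega)
  · rw [Finset.mem_Icc] at hj
    rw [← h.sup_iff j (Finset.mem_Icc.2 (by omega))]
    constructor
    · rintro ⟨D, hD, hs⟩
      exact ⟨D, hmem D hD, hs⟩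
    · rintro ⟨D, hD, hs⟩
      refine ⟨D, Finset.mem_erase.2 ⟨?_, hD⟩, hs⟩
      rintro rfl
      have := le_sup_id hkC
      omega

open Classical in
/-- The finset of all partial families on `{1,…,k}`. -/
noncomputable def partialFamilies (S : ℕ → ℕ) (k : ℕ) : Finset (Finset (Finset ℕ)) :=
  (Finset.Icc 1 k).powerset.powerset.filter (IsPartialFamily S k)

theorem mem_partialFamilies {S : ℕ → ℕ} {k : ℕ} {Q : Finset (Finset ℕ)} :
    Q ∈ partialFamilies S k ↔ IsPartialFamily S k Q := by
  simp only [partialFamilies, Finset.mem_filter, Finset.mem_powerset, and_iff_right_iff_imp]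
  exact fun h C hC => Finset.mem_powerset.2 (h.subset C hC)

theorem card_partialFamilies_succ {S : ℕ → ℕ} {k : ℕ} (h0 : S 0 = 0)
    (hmono : ∀ j < k, S j ≤ S (j + 1)) (hk : S k < S (k + 1)) :
    (partialFamilies S (k + 1)).card =
      (partialFamilies S k).card * (k - S k).choose (S (k + 1) - S k - 1) := by
  have hsum : ((partialFamilies S k).sigma fun Q =>
      Finset.powersetCard (S (k + 1) - S k - 1) (Finset.Icc 1 k \ Q.sup id)).card =
      (partialFamilies S k).card * (k - S k).choose (S (k + 1) - S k - 1) := by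
    rw [Finset.card_sigma, Finset.sum_const_nat]
    intro Q hQ
    have hQ := mem_partialFamilies.1 hQ
    rw [Finset.card_powersetCard, Finset.card_sdiff_of_subset hQ.sup_subset,
      hQ.card_sup h0 hmono, Nat.card_Icc, Nat.add_sub_cancel]
  rw [← hsum]
  symm
  refine Finset.card_bij (fun x _ => insert (insert (k + 1) x.2) x.1) ?_ ?_ ?_
  · rintro ⟨Q, A⟩ hx
    rw [Finset.mem_sigma, mem_partialFamilies, Finset.mem_powersetCard] at hx
    exact mem_partialFamilies.2 (hx.1.insert_succ hk hx.2.1 hx.2.2)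
  · have key : ∀ x ∈ (partialFamilies S k).sigma (fun Q =>
        Finset.powersetCard (S (k + 1) - S k - 1) (Finset.Icc 1 k \ Q.sup id)),
        (insert (insert (k + 1) x.2) x.1).filter (fun C => k + 1 ∉ C) = x.1 ∧
        ((insert (insert (k + 1) x.2) x.1).filter (fun C => k + 1 ∈ C)) =
          {insert (k + 1) x.2} ∧ k + 1 ∉ x.2 := by
      rintro ⟨Q, A⟩ hx
      rw [Finset.mem_sigma, mem_partialFamilies, Finset.mem_powersetCard] at hx
      obtain ⟨hQ, hA, -⟩ := hx
      refine ⟨?_, ?_, fun hm => ?_⟩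
      · rw [Finset.filter_insert, if_neg (by simp)]
        exact Finset.filter_true_of_mem fun C hC => hQ.succ_notMem hC
      · rw [Finset.filter_insert, if_pos (by simp),
          Finset.filter_false_of_mem fun C hC => hQ.succ_notMem hC]
        rfl
      · have := Finset.mem_Icc.1 (Finset.mem_sdiff.1 (hA hm)).1
        omega
    rintro ⟨Q, A⟩ hx ⟨Q', A'⟩ hx' heq
    obtain ⟨h1, h2, h3⟩ := key _ hx
    obtain ⟨h1', h2', h3'⟩ := key _ hx'
    dsimp only at *
    rw [heq] at h1 h2
    obtain rfl : Q = Q' := h1.symm.trans h1'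
    have hins := Finset.singleton_injective (h2.symm.trans h2')
    have hA : A = A' := by
      rw [← Finset.erase_insert h3, hins, Finset.erase_insert h3']
    rw [hA]
  · intro R hR
    have hR := mem_partialFamilies.1 hR
    obtain ⟨C, hC, hs⟩ := (hR.sup_iff (k + 1) (by simp)).2 hk
    have hkC : k + 1 ∈ C := hs ▸ sup_id_mem (hR.nonempty C hC)
    refine ⟨⟨R.erase C, C.erase (k + 1)⟩, ?_, ?_⟩
    · rw [Finset.mem_sigma, mem_partialFamilies, Finset.mem_powersetCard]
      refine ⟨hR.erase_succ hC hkC, fun x hx => ?_, ?_⟩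
      · obtain ⟨hne, hxC⟩ := Finset.mem_erase.1 hx
        have hx1 := Finset.mem_Icc.1 (hR.subset C hC hxC)
        refine Finset.mem_sdiff.2 ⟨Finset.mem_Icc.2 (by omega), fun hxs => ?_⟩
        obtain ⟨D, hD, hxD⟩ := Finset.mem_sup.1 hxs
        obtain ⟨hDne, hDR⟩ := Finset.mem_erase.1 hD
        exact Finset.disjoint_left.1 (hR.disj D hDR C hC hDne) hxD hxC
      · rw [Finset.card_erase_of_mem hkC, hR.card_eq C hC, hs, Nat.add_sub_cancel]
    · simp only [Finset.insert_erase hkC, Finset.insert_erase hC]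

theorem card_partialFamilies {S : ℕ → ℕ} (h0 : S 0 = 0) (k : ℕ) (hle : ∀ j ≤ k, S j ≤ j)
    (hmono : ∀ j < k, S j ≤ S (j + 1)) :
    (partialFamilies S k).card =
      ∏ j ∈ (Finset.Icc 1 k).filter (fun j => S (j - 1) < S j),
        (j - 1 - S (j - 1)).choose (j - S j) := by
  induction k with
  | zero =>
    have h : partialFamilies S 0 = {∅} := by
      ext Q
      rw [mem_partialFamilies, Finset.mem_singleton]
      constructor
      · intro h
        refine Finset.eq_empty_of_forall_notMem fun C hC => ?_
        simpa using h.sup_mem_Icc hC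
      · rintro rfl
        constructor <;> simp
    simp [h]
  | succ k ih =>
    have ih := ih (fun j hj => hle j (by omega)) fun j hj => hmono j (by omega)
    rw [Finset.prod_filter] at ih ⊢
    rw [Finset.prod_Icc_succ_top (by omega), ← ih, Nat.add_sub_cancel]
    split_ifs with hk
    · rw [card_partialFamilies_succ h0 (fun j hj => hmono j (by omega)) hk]
      have h1 := hle (k + 1) le_rfl
      congr 1
      refine Nat.choose_symm_of_eq_add ?_
      omega
    · rw [mul_one]
      congr 1
      ext Q
      rw [mem_partialFamilies, mem_partialFamilies, isPartialFamily_succ_of_eq hk]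

theorem corresponds_iff_isPartialFamily {n : ℕ} {S : ℕ → ℕ} (p : Finpartition (Finset.Icc 1 n)) :
    Corresponds n p S ↔ IsPartialFamily S n p.parts := by
  have hne : ∀ C ∈ p.parts, C.Nonempty := fun C hC => p.nonempty_of_mem_parts hC
  have hsub : ∀ C ∈ p.parts, C ⊆ Finset.Icc 1 n := fun C hC => p.le hC
  constructor
  · intro h
    exact ⟨hne, hsub, fun C hC => (h _ (hsub C hC (sup_id_mem (hne C hC)))).2 C hC rfl,
      fun C hC D hD hCD => p.disjoint hC hD hCD, fun j hj => (h j hj).1⟩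
  · intro h j hj
    refine ⟨h.sup_iff j hj, ?_⟩
    rintro C hC rfl
    exact h.card_eq C hC

theorem IsPartialFamily.exists_finpartition {n : ℕ} {S : ℕ → ℕ} {Q : Finset (Finset ℕ)}
    (h : IsPartialFamily S n Q) (h0 : S 0 = 0) (hn : S n = n)
    (hmono : ∀ j < n, S j ≤ S (j + 1)) :
    ∃ p : Finpartition (Finset.Icc 1 n), p.parts = Q := by
  refine ⟨⟨Q, ?_, ?_, fun hbot => ?_⟩, rfl⟩
  · exact Finset.supIndep_iff_pairwiseDisjoint.2 fun C hC D hD => h.disj C hC D hD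
  · refine Finset.eq_of_subset_of_card_le h.sup_subset ?_
    rw [h.card_sup h0 hmono, hn, Nat.card_Icc, Nat.add_sub_cancel]
  · exact Finset.not_nonempty_empty (h.nonempty _ hbot)

theorem ncard_corresponds {n : ℕ} {S : ℕ → ℕ} (hS : IsSPath n S) :
    {p : Finpartition (Finset.Icc 1 n) | Corresponds n p S}.ncard =
      ∏ j ∈ (Finset.Icc 1 n).filter (fun j => S (j - 1) < S j),
        (j - 1 - S (j - 1)).choose (j - S j) := by
  obtain ⟨h0, hn, hle, hmono⟩ := hS
  have hle' : ∀ j ≤ n, S j ≤ j := fun j hj => by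
    rcases hj.lt_or_eq with hj | rfl
    · exact hle j hj
    · exact hn.le
  rw [← card_partialFamilies h0 n hle' hmono, ← Set.ncard_coe_finset]
  refine Set.ncard_congr (fun p _ => p.parts) ?_ ?_ ?_
  · intro p hp
    exact mem_partialFamilies.2 ((corresponds_iff_isPartialFamily p).1 hp)
  · intro p q _ _ hpq
    exact Finpartition.ext hpq
  · intro Q hQ
    have hQ := mem_partialFamilies.1 hQ
    obtain ⟨p, rfl⟩ := hQ.exists_finpartition h0 hn hmono
    exact ⟨p, (corresponds_iff_isPartialFamily p).2 hQ, rfl⟩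

/-- Suppose `ψ(m_j, j) > 0` for every `j` with `m_j > 0`, and weight each partition by
`w(p) = ∏_{C ∈ p} ψ(|C|, max C)`.  Then `w` takes the same positive value on every
partition corresponding to `S`, and for each such `p`,
`w(p) / Σ_{p' ∈ C_S} w(p') = 1 / ∏_{j : m_j > 0} binom(j-1-S_{j-1}, j-S_j)`:
the conditional distribution induced by `w` on `C_S` is uniform. -/
theorem weights_uniform_on_CS (n : ℕ) (hn : 1 ≤ n) (S : ℕ → ℕ) (hS : IsSPath n S)
    (ψ : ℕ × ℕ → ℝ)
    (hψ : ∀ j ∈ Finset.Icc 1 n, S (j - 1) < S j → 0 < ψ (S j - S (j - 1), j)) :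
    ∀ p : Finpartition (Finset.Icc 1 n), Corresponds n p S →
      (0 < ∏ C ∈ p.parts, ψ (C.card, C.sup id)) ∧
      (∀ p' : Finpartition (Finset.Icc 1 n), Corresponds n p' S →
        ∏ C ∈ p'.parts, ψ (C.card, C.sup id) = ∏ C ∈ p.parts, ψ (C.card, C.sup id)) ∧
      (∏ C ∈ p.parts, ψ (C.card, C.sup id)) /
          (∑ᶠ p' ∈ {p' : Finpartition (Finset.Icc 1 n) | Corresponds n p' S},
            ∏ C ∈ p'.parts, ψ (C.card, C.sup id)) =
        1 / ∏ j ∈ (Finset.Icc 1 n).filter (fun j => S (j - 1) < S j),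
          (Nat.choose (j - 1 - S (j - 1)) (j - S j) : ℝ) := by
  intro p hp
  have hw : ∀ q : Finpartition (Finset.Icc 1 n), Corresponds n q S →
      ∏ C ∈ q.parts, ψ (C.card, C.sup id) =
        ∏ j ∈ (Finset.Icc 1 n).filter (fun j => S (j - 1) < S j), ψ (S j - S (j - 1), j) :=
    fun q hq => ((corresponds_iff_isPartialFamily q).1 hq).prod_eq ψ
  have hpos : 0 < ∏ C ∈ p.parts, ψ (C.card, C.sup id) := by
    rw [hw p hp]
    exact Finset.prod_pos fun j hj =>
      hψ j (Finset.mem_filter.1 hj).1 (Finset.mem_filter.1 hj).2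
  have hconst : ∀ q : Finpartition (Finset.Icc 1 n), Corresponds n q S →
      ∏ C ∈ q.parts, ψ (C.card, C.sup id) = ∏ C ∈ p.parts, ψ (C.card, C.sup id) :=
    fun q hq => (hw q hq).trans (hw p hp).symm
  refine ⟨hpos, hconst, ?_⟩
  have hfin := Set.toFinite {q : Finpartition (Finset.Icc 1 n) | Corresponds n q S}
  rw [finsum_mem_eq_finite_toFinset_sum _ hfin,
    Finset.sum_congr rfl fun q hq => hconst q (hfin.mem_toFinset.1 hq), Finset.sum_const,
    ← Set.ncard_eq_toFinset_card _ hfin, ncard_corresponds hS, nsmul_eq_mul, Nat.cast_prod,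
    div_mul_cancel_right₀ hpos.ne', one_div]
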